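/- Let H be a Hilbert space, a > 0, 1/2 < α ≤ 1, and T : [0,a] → L(H) a strongly continuous family such that T(t) is a compact operator for each t ∈ (0,a] and ‖T(t)‖ ≤ C for all t. Then the linear operator Λ : L²([0,a], H) → H defined by Λ l = ∫₀^a (a-s)^{α-1} T(a-s) l(s) ds is compact. -/

import Mathlib

open MeasureTheory

/-- The operator norm of a strongly continuous family is measurable. -/
theorem aux_measurable_norm {H : Type*} [NormedAddCommGroup H] [NormedSpace ℝ H]
    (B : ℝ → H →L[ℝ] H) (hB : ∀ x, Continuous fun t => B t x) :
    Measurable fun t => ‖B t‖ := by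
  apply measurable_of_Ioi
  intro c
  rcases lt_or_ge c 0 with hc | hc
  · have : (fun t => ‖B t‖) ⁻¹' Set.Ioi c = Set.univ := by
      ext t
      simpa using lt_of_lt_of_le hc (norm_nonneg (B t))
    rw [this]
    exact MeasurableSet.univ
  · have : (fun t => ‖B t‖) ⁻¹' Set.Ioi c = ⋃ x : H, {t | c * ‖x‖ < ‖B t x‖} := by
      ext t
      simp only [Set.mem_preimage, Set.mem_Ioi, Set.mem_iUnion, Set.mem_setOf_eq]
      constructor
      · intro h
        by_contra! hcon
        exact absurd (ContinuousLinearMap.opNorm_le_bound (B t) hc hcon) (not_le.mpr h)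
      · rintro ⟨x, hx⟩
        have h1 := hx.trans_le ((B t).le_opNorm x)
        exact lt_of_mul_lt_mul_right h1 (norm_nonneg x)
    rw [this]
    exact (isOpen_iUnion fun x => isOpen_lt continuous_const (hB x).norm).measurableSet

theorem aux_compact_proj {H : Type*} [NormedAddCommGroup H] [InnerProductSpace ℝ H]
    (V : Submodule ℝ H) [FiniteDimensional ℝ V] : IsCompactOperator V.starProjection := by
  have h : IsCompactOperator (id : V → V) :=
    (isCompactOperator_id_iff_finiteDimensional (𝕜 := ℝ)).2 inferInstance
  have h2 := (h.comp_clm V.orthogonalProjection).clm_comp V.subtypeL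
  exact h2

theorem aux_dist_proj {H : Type*} [NormedAddCommGroup H] [InnerProductSpace ℝ H]
    (V : Submodule ℝ H) [V.HasOrthogonalProjection] (y v : H) (hv : v ∈ V) :
    ‖y - V.starProjection y‖ ≤ ‖y - v‖ := by
  rw [Submodule.starProjection_minimal]
  exact ciInf_le ⟨0, by rintro _ ⟨x, rfl⟩; positivity⟩ (⟨v, hv⟩ : V)

/-- A sequence of compact contractions `P n` with `id - P n` contractive, converging uniformly
on compact sets contained in the closure of a given sequence. -/
theorem aux_proj_seq {H : Type*} [NormedAddCommGroup H] [InnerProductSpace ℝ H]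
    (u : ℕ → H) : ∃ P : ℕ → H →L[ℝ] H, (∀ n, IsCompactOperator (P n)) ∧
      (∀ n y, ‖y - P n y‖ ≤ ‖y‖) ∧
      ∀ K : Set H, IsCompact K → K ⊆ closure (Set.range u) → ∀ ε > 0, ∃ N, ∀ n ≥ N, ∀ y ∈ K,
        ‖y - P n y‖ ≤ ε := by
  let V : ℕ → Submodule ℝ H := fun n => Submodule.span ℝ (u '' (Set.Iio n))
  have hfin : ∀ n, FiniteDimensional ℝ (V n) := fun n =>
    FiniteDimensional.span_of_finite ℝ ((Set.finite_Iio n).image u)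
  refine ⟨fun n => (V n).starProjection, fun n => aux_compact_proj _, fun n y => ?_, ?_⟩
  · simpa using aux_dist_proj (V n) y 0 (Submodule.zero_mem _)
  · intro K hK hKu ε hε
    obtain ⟨t, ht⟩ := hK.elim_finite_subcover (fun k : ℕ => Metric.ball (u k) ε)
      (fun _ => Metric.isOpen_ball) (by
        intro y hy
        obtain ⟨_, ⟨k, rfl⟩, hk⟩ := Metric.mem_closure_iff.1 (hKu hy) ε hε
        exact Set.mem_iUnion.2 ⟨k, hk⟩)
    refine ⟨t.sup id + 1, fun n hn y hy => ?_⟩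
    obtain ⟨k, hkt, hk⟩ := Set.mem_iUnion₂.1 (ht hy)
    have hkn : k < n := by
      have : k ≤ t.sup id := Finset.le_sup (f := id) hkt
      omega
    have hk' : ‖y - u k‖ < ε := by simpa [dist_eq_norm] using hk
    exact (aux_dist_proj (V n) y (u k)
      (Submodule.subset_span ⟨k, hkn, rfl⟩)).trans hk'.le

/-- Images of the unit ball under the family lie in the closure of one sequence. -/
theorem aux_separable {H : Type*} [NormedAddCommGroup H] [InnerProductSpace ℝ H]
    (T : ℝ → H →L[ℝ] H) (hT : ∀ x, Continuous fun t => T t x)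
    (hc : ∀ t, 0 < t → IsCompactOperator (T t)) :
    ∃ u : ℕ → H, ∀ t, 0 < t → ∀ x, ‖x‖ ≤ 1 → T t x ∈ closure (Set.range u) := by
  have hsep : TopologicalSpace.IsSeparable
      (⋃ q : {q : ℚ // (0:ℝ) < q}, T (q : ℚ) '' Metric.closedBall 0 1) := by
    refine TopologicalSpace.IsSeparable.iUnion fun q => ?_
    obtain ⟨K, hK, hKs⟩ := IsCompactOperator.image_closedBall_subset_compact
      (f := (T ((q : ℚ) : ℝ)).toLinearMap) (hc _ q.2) 1
    exact hK.isSeparable.mono hKs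
  obtain ⟨c, hcc, hcs⟩ := hsep
  obtain ⟨u, hu⟩ := (hcc.insert 0).exists_eq_range (Set.insert_nonempty _ _)
  refine ⟨u, fun t ht x hx => ?_⟩
  have hcu : closure c ⊆ closure (Set.range u) :=
    closure_mono (hu ▸ Set.subset_insert _ _)
  have h1 : t ∈ closure (Set.Ioi 0 ∩ Set.range ((↑) : ℚ → ℝ)) :=
    Rat.isDenseEmbedding_coe_real.dense.open_subset_closure_inter isOpen_Ioi ht
  have h2 := map_mem_closure (hT x) h1 (t := closure (Set.range u)) (by
    rintro _ ⟨h0, q, rfl⟩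
    apply hcu
    apply hcs
    refine Set.mem_iUnion.2 ⟨⟨q, h0⟩, x, by simpa using hx, rfl⟩)
  simpa using h2

theorem aux_weight (a α : ℝ) (ha : 0 < a) (hα : 1/2 < α) :
    ∫⁻ s in Set.Ioc (0:ℝ) a, ‖(a - s) ^ (α - 1)‖ₑ ^ (2:ℝ) ≠ ⊤ := by
  have h1 : IntervalIntegrable (fun x : ℝ => x ^ (2 * α - 2)) volume (a - 0) (a - a) :=
    intervalIntegral.intervalIntegrable_rpow' (by linarith)
  have h2 : IntervalIntegrable (fun s : ℝ => (a - s) ^ (2 * α - 2)) volume 0 a := by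
    simpa using (h1.comp_sub_left a)
  have h3 := (intervalIntegrable_iff_integrableOn_Ioo_of_le ha.le).1 h2
  have h4 := h3.2
  rw [Measure.restrict_congr_set Ioo_ae_eq_Ioc.symm]
  refine ne_of_lt (lt_of_le_of_lt (le_of_eq ?_) h4)
  refine setLIntegral_congr_fun measurableSet_Ioo fun s hs => ?_
  have h0 : 0 < a - s := by linarith [hs.2]
  have e : (a - s) ^ (2 * α - 2) = ((a - s) ^ (α - 1)) ^ 2 := by
    rw [← Real.rpow_natCast, ← Real.rpow_mul h0.le]
    congr 1
    push_cast
    ring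
  simp only [e, enorm_pow]
  norm_num

/-- Compactness of the convolution-type operator
`Λ l = ∫₀^a (a-s)^{α-1} T(a-s) l(s) ds` on `L²([0,a], H)`, when `T` is a
strongly continuous, uniformly bounded family of operators that are compact
for `t ∈ (0,a]` and `1/2 < α ≤ 1`. -/
theorem convolution_operator_compact {H : Type*} [NormedAddCommGroup H]
    [InnerProductSpace ℝ H] [CompleteSpace H]
    (a α C : ℝ) (ha : 0 < a) (hα : 1/2 < α) (hα1 : α ≤ 1)
    (T : ℝ → H →L[ℝ] H)
    (hTcont : ∀ x : H, ContinuousOn (fun t => (T t) x) (Set.Icc 0 a))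
    (hTcompact : ∀ t ∈ Set.Ioc (0:ℝ) a, IsCompactOperator (T t))
    (hTbound : ∀ t ∈ Set.Icc (0:ℝ) a, ‖T t‖ ≤ C)
    (Λ : Lp H 2 (volume.restrict (Set.Ioc (0:ℝ) a)) →L[ℝ] H)
    (hΛ : ∀ l : Lp H 2 (volume.restrict (Set.Ioc (0:ℝ) a)),
      Λ l = ∫ s in Set.Ioc (0:ℝ) a, (a - s) ^ (α - 1) • (T (a - s)) (l s)) :
    IsCompactOperator Λ := by
  -- extend the family to the whole line
  obtain ⟨S, hSc, hSk, hSb, hST⟩ : ∃ S : ℝ → H →L[ℝ] H, (∀ x, Continuous fun t => S t x) ∧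
      (∀ t, 0 < t → IsCompactOperator (S t)) ∧ (∀ t, ‖S t‖ ≤ C) ∧
      ∀ t ∈ Set.Icc (0:ℝ) a, S t = T t := by
    refine ⟨fun t => T (Set.projIcc 0 a ha.le t), fun x => ?_, fun t ht => ?_, fun t => ?_,
      fun t ht => ?_⟩
    · exact (hTcont x).comp_continuous (continuous_subtype_val.comp continuous_projIcc)
        (fun t => (Set.projIcc 0 a ha.le t).2)
    · apply hTcompact
      refine ⟨?_, (Set.projIcc 0 a ha.le t).2.2⟩
      simp [Set.coe_projIcc, ha, ht]
    · exact hTbound _ (Set.projIcc 0 a ha.le t).2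
    · simp [Set.projIcc_of_mem ha.le ht]
  have hC : 0 ≤ C := (norm_nonneg _).trans (hSb 0)
  obtain ⟨u, hu⟩ := aux_separable S hSc hSk
  obtain ⟨P, hPk, hP1, hPu⟩ := aux_proj_seq u
  let A : ℕ → H →L[ℝ] H := fun n => ContinuousLinearMap.id ℝ H - P n
  have hA : ∀ n y, A n y = y - P n y := fun n y => rfl
  let B : ℕ → ℝ → H →L[ℝ] H := fun n t => (A n).comp (S t)
  have hBmeas : ∀ n, Measurable fun t => ‖B n t‖ := fun n =>
    aux_measurable_norm (B n) fun x => (A n).continuous.comp (hSc x)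
  have hBle : ∀ n t, ‖B n t‖ ≤ C := by
    intro n t
    refine ContinuousLinearMap.opNorm_le_bound _ hC fun x => ?_
    calc ‖B n t x‖ ≤ ‖S t x‖ := hP1 n (S t x)
      _ ≤ ‖S t‖ * ‖x‖ := (S t).le_opNorm x
      _ ≤ C * ‖x‖ := by gcongr; exact hSb t
  have hBlim : ∀ t, 0 < t → Filter.Tendsto (fun n => ‖B n t‖) Filter.atTop (nhds 0) := by
    intro t ht
    obtain ⟨K, hK, hKs⟩ := IsCompactOperator.image_closedBall_subset_compact
      (f := (S t).toLinearMap) (hSk t ht) 1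
    have hK' := hK.inter_right (isClosed_closure (s := Set.range u))
    rw [Metric.tendsto_atTop]
    intro ε hε
    obtain ⟨N, hN⟩ := hPu _ hK' Set.inter_subset_right (ε / 2) (half_pos hε)
    refine ⟨N, fun n hn => ?_⟩
    have : ‖B n t‖ ≤ ε / 2 := by
      refine ContinuousLinearMap.opNorm_le_of_unit_norm (half_pos hε).le fun x hx => ?_
      exact hN n hn _ ⟨hKs ⟨x, by simp [hx], rfl⟩, hu t ht x hx.le⟩
    simp only [dist_zero_right, norm_norm]
    linarith
  let F : ℕ → ℝ → ENNReal := fun n s => ‖(a - s) ^ (α - 1)‖ₑ * ‖B n (a - s)‖ₑ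
  have hFmeas : ∀ n, Measurable (F n) := by
    intro n
    have h1 : Measurable fun s : ℝ => ‖(a - s) ^ (α - 1)‖ₑ := by fun_prop
    have h2 : Measurable fun s : ℝ => ‖B n (a - s)‖ₑ := by
      have := ((hBmeas n).comp (measurable_const.sub measurable_id : Measurable fun s : ℝ => a - s)).ennreal_ofReal
      simpa [Function.comp_def, ofReal_norm_eq_enorm] using this
    exact h1.mul h2
  have hlim : Filter.Tendsto (fun n => (∫⁻ s in Set.Ioc (0:ℝ) a, F n s ^ (2:ℝ)) ^ (1 / 2 : ℝ))
      Filter.atTop (nhds 0) := by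
    have h : Filter.Tendsto (fun n => ∫⁻ s in Set.Ioc (0:ℝ) a, F n s ^ (2:ℝ))
      Filter.atTop (nhds (∫⁻ s in Set.Ioc (0:ℝ) a, 0)) := by
      refine tendsto_lintegral_of_dominated_convergence
        (fun s => ‖(a - s) ^ (α - 1)‖ₑ ^ (2:ℝ) * ENNReal.ofReal C ^ (2:ℝ))
        (fun n => (hFmeas n).pow_const _) (fun n => Filter.Eventually.of_forall fun s => ?_) ?_ ?_
      · simp only [F]
        rw [ENNReal.mul_rpow_of_nonneg _ _ (by norm_num : (0:ℝ) ≤ 2)]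
        gcongr
        rw [← ofReal_norm_eq_enorm]
        exact ENNReal.ofReal_le_ofReal (hBle n _)
      · rw [lintegral_mul_const' _ _ (by simp)]
        exact ENNReal.mul_ne_top (aux_weight a α ha hα) (by simp)
      · rw [Measure.restrict_congr_set Ioo_ae_eq_Ioc.symm]
        refine (ae_restrict_iff' measurableSet_Ioo).2 (Filter.Eventually.of_forall fun s hs => ?_)
        have h1 : Filter.Tendsto (fun n => ‖B n (a - s)‖ₑ) Filter.atTop (nhds 0) := by
          have := ENNReal.tendsto_ofReal (hBlim (a - s) (by linarith [hs.2]))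
          simpa [ofReal_norm_eq_enorm] using this
        have h2 := ENNReal.Tendsto.const_mul (a := ‖(a - s) ^ (α - 1)‖ₑ) h1 (Or.inr (by simp))
        have h3 := (ENNReal.continuous_rpow_const (y := (2:ℝ))).tendsto _ |>.comp h2
        simpa [Function.comp_def] using h3
    have h3 := (ENNReal.continuous_rpow_const (y := (1 / 2:ℝ))).tendsto _ |>.comp h
    simpa [Function.comp_def] using h3
  have hbound : ∀ n, ‖(P n).comp Λ - Λ‖ₑ ≤
      (∫⁻ s in Set.Ioc (0:ℝ) a, F n s ^ (2:ℝ)) ^ (1 / 2 : ℝ) := by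
    intro n
    refine ContinuousLinearMap.opENorm_le_bound _ fun l => ?_
    have e1 : ((P n).comp Λ - Λ) l = - A n (Λ l) := by
      simp [hA]
    rw [e1, enorm_neg, hΛ]
    by_cases hint : Integrable (fun s => (a - s) ^ (α - 1) • (T (a - s)) (l s))
      (volume.restrict (Set.Ioc (0:ℝ) a))
    · rw [← (A n).integral_comp_comm hint]
      refine (enorm_integral_le_lintegral_enorm _).trans ?_
      have hl : AEMeasurable (fun s => ‖l s‖ₑ) (volume.restrict (Set.Ioc (0:ℝ) a)) :=
        (Lp.aestronglyMeasurable l).enorm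
      have hH := ENNReal.lintegral_mul_le_Lp_mul_Lq (volume.restrict (Set.Ioc (0:ℝ) a))
        Real.HolderConjugate.two_two (hFmeas n).aemeasurable hl
      rw [Lp.enorm_def, eLpNorm_eq_lintegral_rpow_enorm_toReal (by simp) (by simp)]
      refine le_trans ?_ hH
      refine setLIntegral_mono_ae' measurableSet_Ioc (Filter.Eventually.of_forall fun s hs => ?_)
      rw [map_smul, enorm_smul, ← hST (a - s) ⟨by linarith [hs.2], by linarith [hs.1]⟩]
      simp only [Pi.mul_apply, F, mul_assoc]
      gcongr
      exact (B n (a - s)).le_opENorm (l s)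
    · rw [integral_undef hint]
      simp
  refine isCompactOperator_of_tendsto (F := fun n => (P n).comp Λ) (l := Filter.atTop) ?_
    (Filter.Eventually.of_forall fun n => (hPk n).comp_clm Λ)
  rw [tendsto_iff_edist_tendsto_0]
  refine tendsto_of_tendsto_of_tendsto_of_le_of_le tendsto_const_nhds hlim
    (fun _ => zero_le) fun n => ?_
  simp only [edist_eq_enorm_sub]
  exact hbound n
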